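/- Let q ≥ 1 be an integer and ψ̄ ∈ 𝒟̄^q. Then γ_i ∈ 𝒞^{↑,q} for every i = 0, 1, …, I, and γ_0'(z) ≥ 1 > 0 for all z ∈ ℝ₊. -/

import Mathlib

open Set Filter

noncomputable section

/-- `f ∈ 𝒞`: continuous, non-decreasing, `ℝ₊`-valued on `ℝ₊`, with `f 0 = 0`. -/
def memC (f : ℝ → ℝ) : Prop :=
  ContinuousOn f (Ici 0) ∧ MonotoneOn f (Ici 0) ∧ f 0 = 0 ∧ ∀ u ∈ Ici (0:ℝ), 0 ≤ f u

/-- `f ∈ 𝒞^↑`: member of `𝒞` that is strictly increasing and tends to `∞` at `∞`. -/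
def memCup (f : ℝ → ℝ) : Prop :=
  memC f ∧ StrictMonoOn f (Ici 0) ∧ Tendsto f atTop atTop

/-- the soliton size associated with the index `i : Fin I`, namely `i+1`, as a real number. -/
def sz {I : ℕ} (i : Fin I) : ℝ := (i : ℕ) + 1

/-- the effective-distance (integrated slot density) function `φ_i`. -/
def phi {I : ℕ} (ψ : Fin I → ℝ → ℝ) (i : Fin I) (u : ℝ) : ℝ :=
  u - ∑ j, 2 * min (sz i) (sz j) * ψ j u

/-- the top effective-distance function `φ_I` (note `min (I, j) = j` for `j ≤ I`). -/
def phiTop {I : ℕ} (ψ : Fin I → ℝ → ℝ) (u : ℝ) : ℝ :=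
  u - ∑ j, 2 * sz j * ψ j u

/-- `ψ ∈ 𝓕`. -/
def memF {I : ℕ} (ψ : Fin I → ℝ → ℝ) : Prop :=
  (∀ i, memC (ψ i)) ∧ memCup (phiTop ψ)

/-- the inverse of `f : ℝ₊ → ℝ₊` (as a function `ℝ → ℝ` supported in domain `Ici 0`). -/
def rinv (f : ℝ → ℝ) : ℝ → ℝ := Function.invFunOn f (Ici 0)

/-- the effective scaling (scattering) map `Υ`. -/
def Upsilon {I : ℕ} (ψ : Fin I → ℝ → ℝ) : Fin I → ℝ → ℝ :=
  fun i => ψ i ∘ rinv (phi ψ i)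

/-- `gammaK ψb k = γ_{I-k}`, defined by downward recursion from `γ_I = id`:
`γ_i(z) = z + ∑_{j>i} 2(j-i) ψb_j (γ_j z)`. -/
def gammaK {I : ℕ} (ψb : Fin I → ℝ → ℝ) : ℕ → ℝ → ℝ
  | 0 => fun z => z
  | k + 1 => fun z =>
      z + ∑ m ∈ (Finset.range (k + 1)).attach,
        2 * (((k + 1 : ℕ) : ℝ) - ((m : ℕ) : ℝ)) *
          (if h : (m : ℕ) < I then
              ψb ⟨I - 1 - (m : ℕ), by omega⟩ (gammaK ψb (m : ℕ) z)
            else 0)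
  termination_by k => k
  decreasing_by have hm := Finset.mem_range.mp m.2; omega

/-- `γ_i`, for `i = 0, 1, …, I`. -/
def gam {I : ℕ} (ψb : Fin I → ℝ → ℝ) (i : ℕ) : ℝ → ℝ := gammaK ψb (I - i)

/-- the spatial reconstruction (inverse scattering) map `Γ`. -/
def Gamma {I : ℕ} (ψb : Fin I → ℝ → ℝ) : Fin I → ℝ → ℝ :=
  fun i => ψb i ∘ gam ψb ((i : ℕ) + 1) ∘ rinv (gam ψb 0)

/-- the free-evolution shift `θ_t`. -/
def theta {I : ℕ} (t : ℝ) (ψb : Fin I → ℝ → ℝ) : Fin I → ℝ → ℝ :=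
  fun i z => ψb i (max (z - sz i * t) 0)

/-- `ψ ∈ 𝒟`: member of `𝓕` satisfying the density condition
`∑_i i · sup_{u₁≠u₂} (ψ_i(u₁)-ψ_i(u₂))/(φ_i(u₁)-φ_i(u₂)) < 1/2`. -/
def memD {I : ℕ} (ψ : Fin I → ℝ → ℝ) : Prop :=
  memF ψ ∧
  ∃ c : Fin I → ℝ,
    (∀ i, ∀ u₁ ∈ Ici (0:ℝ), ∀ u₂ ∈ Ici (0:ℝ), u₂ < u₁ →
      ψ i u₁ - ψ i u₂ ≤ c i * (phi ψ i u₁ - phi ψ i u₂)) ∧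
    ∑ i, sz i * c i < 1 / 2

/-- `ψb ∈ 𝒟̄`: member of `𝒞^I` satisfying the density condition
`∑_i i · sup_{z₁≠z₂} (ψb_i(z₁)-ψb_i(z₂))/(z₁-z₂) < 1/2`. -/
def memDbar {I : ℕ} (ψb : Fin I → ℝ → ℝ) : Prop :=
  (∀ i, memC (ψb i)) ∧
  ∃ c : Fin I → ℝ,
    (∀ i, ∀ z₁ ∈ Ici (0:ℝ), ∀ z₂ ∈ Ici (0:ℝ), z₂ < z₁ →
      ψb i z₁ - ψb i z₂ ≤ c i * (z₁ - z₂)) ∧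
    ∑ i, sz i * c i < 1 / 2

/-- the extension `f^ℝ` of `f` to `ℝ`, by `0` on the negative half-line. -/
def extZ (f : ℝ → ℝ) : ℝ → ℝ := fun u => if 0 ≤ u then f u else 0

/-- the extension `f^{ℝ,↑}` of `f` to `ℝ`, by the identity on the negative half-line. -/
def extId (f : ℝ → ℝ) : ℝ → ℝ := fun u => if 0 ≤ u then f u else u

/-- `f ∈ 𝒞^q`. -/
def memCq (q : ℕ) (f : ℝ → ℝ) : Prop := memC f ∧ ContDiff ℝ q (extZ f)

/-- `f ∈ 𝒞^{↑,q}`. -/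
def memCupq (q : ℕ) (f : ℝ → ℝ) : Prop := memCup f ∧ ContDiff ℝ q (extId f)

/-- `f ∈ C^q(ℝ₊², ℝ₊)`: `ℝ₊`-valued and `q`-times continuously differentiable on the
quadrant (one-sided at the boundary). -/
def memCqTwo (q : ℕ) (f : ℝ → ℝ → ℝ) : Prop :=
  (∀ u ∈ Ici (0:ℝ), ∀ t ∈ Ici (0:ℝ), 0 ≤ f u t) ∧
  ContDiffOn ℝ q (fun p : ℝ × ℝ => f p.1 p.2) (Ici 0 ×ˢ Ici 0)

/-- the matrix `M(ρ)`. -/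
def Mmat {I : ℕ} (ρ : Fin I → ℝ) : Matrix (Fin I) (Fin I) ℝ :=
  Matrix.of fun i j =>
    if i = j then 1 - ∑ k ∈ Finset.univ.erase i, 2 * min (sz i) (sz k) * ρ k
    else 2 * min (sz i) (sz j) * ρ j

/-- the effective speeds `v^eff(ρ) = M(ρ)⁻¹ v`, where `v_i = i`. -/
def veff {I : ℕ} (ρ : Fin I → ℝ) : Fin I → ℝ :=
  ((Mmat ρ)⁻¹).mulVec fun i => sz i

/-- `ρ ∈ 𝒟_density`. -/
def memDdensity {I : ℕ} (ρ : Fin I → ℝ → ℝ) : Prop :=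
  (∀ i, (∀ u ∈ Ici (0:ℝ), 0 ≤ ρ i u) ∧ ContDiff ℝ 1 (extZ (ρ i))) ∧
  (∀ u ∈ Ici (0:ℝ), ∑ i, 2 * sz i * ρ i u < 1) ∧
  ∃ c : Fin I → ℝ,
    (∀ i, ∀ u ∈ Ici (0:ℝ),
      ρ i u ≤ c i * (1 - ∑ j, 2 * min (sz i) (sz j) * ρ j u)) ∧
    ∑ i, sz i * c i < 1 / 2

lemma memC_zero : memC (fun _ => 0) :=
  ⟨continuousOn_const, monotoneOn_const, rfl, fun _ _ => le_rfl⟩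

lemma memC.add {f g : ℝ → ℝ} (hf : memC f) (hg : memC g) : memC (fun z => f z + g z) :=
  ⟨hf.1.add hg.1, hf.2.1.add hg.2.1, by simp [hf.2.2.1, hg.2.2.1],
    fun u hu => add_nonneg (hf.2.2.2 u hu) (hg.2.2.2 u hu)⟩

lemma memC.const_mul {f : ℝ → ℝ} (hf : memC f) {a : ℝ} (ha : 0 ≤ a) :
    memC (fun z => a * f z) :=
  ⟨hf.1.const_mul a, fun _ hx _ hy hxy => mul_le_mul_of_nonneg_left (hf.2.1 hx hy hxy) ha,
    by simp [hf.2.2.1], fun u hu => mul_nonneg ha (hf.2.2.2 u hu)⟩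

lemma memC.comp {f g : ℝ → ℝ} (hf : memC f) (hg : memC g) : memC (fun z => f (g z)) :=
  ⟨hf.1.comp hg.1 hg.2.2.2,
    fun _ hx _ hy hxy => hf.2.1 (hg.2.2.2 _ hx) (hg.2.2.2 _ hy) (hg.2.1 hx hy hxy),
    by simp [hf.2.2.1, hg.2.2.1], fun u hu => hf.2.2.2 _ (hg.2.2.2 u hu)⟩

lemma memC.memCup_id_add {g : ℝ → ℝ} (hg : memC g) : memCup (fun z => z + g z) := by
  refine ⟨⟨continuousOn_id.add hg.1, monotoneOn_id.add hg.2.1, by simp [hg.2.2.1],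
    fun u hu => add_nonneg hu (hg.2.2.2 u hu)⟩, ?_, ?_⟩
  · exact fun x hx y hy hxy => add_lt_add_of_lt_of_le hxy (hg.2.1 hx hy hxy.le)
  · refine tendsto_atTop_mono' _ ?_ tendsto_id
    filter_upwards [eventually_ge_atTop 0] with z hz
    exact le_add_of_nonneg_right (hg.2.2.2 z hz)

lemma monotone_extZ {g : ℝ → ℝ} (hg : memC g) : Monotone (extZ g) := by
  intro x y hxy
  unfold extZ
  split_ifs with hx hy hy
  · exact hg.2.1 hx hy hxy
  · exact absurd (hx.trans hxy) hy
  · exact hg.2.2.2 y hy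
  · exact le_rfl

lemma extId_id_add (g : ℝ → ℝ) : extId (fun z => z + g z) = fun z => z + extZ g z := by
  funext z
  unfold extId extZ
  split_ifs <;> simp

lemma extZ_comp {g : ℝ → ℝ} (f : ℝ → ℝ) (hg : memC g) :
    extZ (fun z => f (g z)) = fun z => extZ f (extId g z) := by
  funext z
  by_cases hz : 0 ≤ z
  · simp [extZ, extId, hz, hg.2.2.2 z hz]
  · simp [extZ, extId, hz]

lemma memCq_zero (q : ℕ) : memCq q (fun _ => 0) := by
  refine ⟨memC_zero, ?_⟩
  have h : extZ (fun _ => 0) = fun _ => 0 := by funext z; simp [extZ]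
  rw [h]
  exact contDiff_const

lemma memCq.add {q : ℕ} {f g : ℝ → ℝ} (hf : memCq q f) (hg : memCq q g) :
    memCq q (fun z => f z + g z) := by
  refine ⟨hf.1.add hg.1, ?_⟩
  have h : extZ (fun z => f z + g z) = fun z => extZ f z + extZ g z := by
    funext z
    unfold extZ
    split_ifs <;> simp
  rw [h]
  exact hf.2.add hg.2

lemma memCq.const_mul {q : ℕ} {f : ℝ → ℝ} (hf : memCq q f) {a : ℝ} (ha : 0 ≤ a) :
    memCq q (fun z => a * f z) := by
  refine ⟨hf.1.const_mul ha, ?_⟩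
  have h : extZ (fun z => a * f z) = fun z => a * extZ f z := by
    funext z
    unfold extZ
    split_ifs <;> simp
  rw [h]
  exact contDiff_const.mul hf.2

lemma memCq_sum {ι : Type*} {q : ℕ} (s : Finset ι) {f : ι → ℝ → ℝ}
    (hf : ∀ i ∈ s, memCq q (f i)) : memCq q (fun z => ∑ i ∈ s, f i z) := by
  classical
  induction s using Finset.induction_on with
  | empty => simpa using memCq_zero q
  | insert a s ha ih =>
    simp only [Finset.sum_insert ha]
    exact (hf a (Finset.mem_insert_self a s)).add
      (ih fun i hi => hf i (Finset.mem_insert_of_mem hi))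

lemma memCq.comp {q : ℕ} {f g : ℝ → ℝ} (hf : memCq q f) (hg : memCupq q g) :
    memCq q (fun z => f (g z)) := by
  refine ⟨hf.1.comp hg.1.1, ?_⟩
  rw [extZ_comp f hg.1.1]
  exact hf.2.comp hg.2

lemma memCq.memCupq_id_add {q : ℕ} {g : ℝ → ℝ} (hg : memCq q g) :
    memCupq q (fun z => z + g z) := by
  refine ⟨hg.1.memCup_id_add, ?_⟩
  rw [extId_id_add]
  exact contDiff_id.add hg.2

lemma memCq.one_le_deriv_extId {q : ℕ} (hq : 1 ≤ q) {g : ℝ → ℝ} (hg : memCq q g) (z : ℝ) :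
    1 ≤ deriv (extId (fun z => z + g z)) z := by
  have hq' : ((q : ℕ) : WithTop ℕ∞) ≠ 0 := by exact_mod_cast (by omega : q ≠ 0)
  have hd : DifferentiableAt ℝ (extZ g) z := (hg.2.differentiable hq').differentiableAt
  rw [extId_id_add, ((hasDerivAt_id' z).fun_add hd.hasDerivAt).deriv]
  exact le_add_of_nonneg_right (monotone_extZ hg.1).deriv_nonneg

/-- Every `γ_i` is the identity plus a member of `𝒞^q`. -/
lemma exists_gammaK_eq_id_add {I q : ℕ} {ψb : Fin I → ℝ → ℝ} (hψ : ∀ i, memCq q (ψb i)) (k : ℕ) :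
    ∃ g, memCq q g ∧ gammaK ψb k = fun z => z + g z := by
  induction k using Nat.strong_induction_on with
  | _ k ih =>
    cases k with
    | zero => exact ⟨fun _ => 0, memCq_zero q, by rw [gammaK]; simp⟩
    | succ k =>
      refine ⟨_, memCq_sum _ fun m _ => ?_, by rw [gammaK]⟩
      have hm : (m : ℕ) < k + 1 := Finset.mem_range.mp m.2
      have hm' : ((m : ℕ) : ℝ) ≤ ((k + 1 : ℕ) : ℝ) := by exact_mod_cast hm.le
      refine memCq.const_mul ?_ (by linarith)
      split_ifs with h
      · obtain ⟨g, hg, hgeq⟩ := ih m hm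
        refine (hψ _).comp ?_
        rw [hgeq]
        exact hg.memCupq_id_add
      · exact memCq_zero q

/-- for `ψb ∈ 𝒟̄^q`, each `γ_i`, `i = 0, 1, …, I`, belongs to `𝒞^{↑,q}`,
and `γ_0'(z) ≥ 1 > 0` for all `z ∈ ℝ₊`. -/
theorem stmt_12 {I : ℕ} (hI : 1 ≤ I) (q : ℕ) (hq : 1 ≤ q) (ψb : Fin I → ℝ → ℝ)
    (hD : memDbar ψb) (hCq : ∀ i, memCq q (ψb i)) :
    (∀ i : ℕ, i ≤ I → memCupq q (gam ψb i)) ∧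
    (∀ z ∈ Ici (0:ℝ), 1 ≤ deriv (extId (gam ψb 0)) z) := by
  refine ⟨fun i _ => ?_, fun z _ => ?_⟩
  · obtain ⟨g, hg, hgeq⟩ := exists_gammaK_eq_id_add hCq (I - i)
    rw [gam, hgeq]
    exact hg.memCupq_id_add
  · obtain ⟨g, hg, hgeq⟩ := exists_gammaK_eq_id_add hCq (I - 0)
    rw [gam, hgeq]
    exact hg.one_le_deriv_extId hq z
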